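/- The function Z(x) = (x³/6)·V₀'(x) satisfies Z''(x) + exp(V₀(x))·Z(x) = x·V₀'(x) − x²·exp(V₀(x)) for all x ∈ ℝ. -/

import Mathlib

noncomputable def V₀ (x : ℝ) : ℝ :=
  Real.log (4 * Real.exp (Real.sqrt 2 * x) / (1 + Real.exp (Real.sqrt 2 * x)) ^ 2)

theorem exp_V₀ (x : ℝ) : Real.exp (V₀ x) =
    4 * Real.exp (Real.sqrt 2 * x) / (1 + Real.exp (Real.sqrt 2 * x)) ^ 2 := by
  unfold V₀
  rw [Real.exp_log (by positivity)]

theorem hasDerivAt_E (x : ℝ) : HasDerivAt (fun y : ℝ => Real.exp (Real.sqrt 2 * y))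
    (Real.exp (Real.sqrt 2 * x) * Real.sqrt 2) x := by
  simpa using ((hasDerivAt_id x).const_mul (Real.sqrt 2)).exp

theorem hasDerivAt_V₀ (x : ℝ) : HasDerivAt V₀
    (Real.sqrt 2 * (1 - Real.exp (Real.sqrt 2 * x)) / (1 + Real.exp (Real.sqrt 2 * x))) x := by
  have hp := Real.exp_pos (Real.sqrt 2 * x)
  have h := (((hasDerivAt_E x).const_mul 4).div (((hasDerivAt_E x).const_add 1).pow 2)
    (by simp only [Pi.pow_apply]; positivity)).log (by simp only [Pi.div_apply, Pi.pow_apply]; positivity)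
  refine HasDerivAt.congr_deriv (f := V₀) h ?_
  simp only [Pi.div_apply, Pi.pow_apply]
  field_simp
  ring

theorem deriv_V₀ : deriv V₀ = fun x =>
    Real.sqrt 2 * (1 - Real.exp (Real.sqrt 2 * x)) / (1 + Real.exp (Real.sqrt 2 * x)) :=
  funext fun x => (hasDerivAt_V₀ x).deriv

theorem hasDerivAt_deriv_V₀ (x : ℝ) : HasDerivAt (deriv V₀) (-Real.exp (V₀ x)) x := by
  have hp := Real.exp_pos (Real.sqrt 2 * x)
  have hs : Real.sqrt 2 ^ 2 = 2 := Real.sq_sqrt (by norm_num)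
  rw [deriv_V₀, exp_V₀]
  have h := (((hasDerivAt_E x).const_sub 1).const_mul (Real.sqrt 2)).div
    ((hasDerivAt_E x).const_add 1) (by positivity)
  refine HasDerivAt.congr_deriv h ?_
  rw [← neg_div]
  congr 1
  linear_combination (-2 * Real.exp (Real.sqrt 2 * x)) * hs

theorem stmt_11 :
    ∀ x : ℝ,
      deriv (deriv (fun y : ℝ => y ^ 3 / 6 * deriv V₀ y)) x +
          Real.exp (V₀ x) * (x ^ 3 / 6 * deriv V₀ x) =
        x * deriv V₀ x - x ^ 2 * Real.exp (V₀ x) := by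
  intro x
  have h1 : deriv (fun y : ℝ => y ^ 3 / 6 * deriv V₀ y) =
      fun y => (3 * y ^ 2) / 6 * deriv V₀ y + y ^ 3 / 6 * (-Real.exp (V₀ y)) := by
    funext y
    have h := ((hasDerivAt_pow 3 y).div_const 6).mul (hasDerivAt_deriv_V₀ y)
    refine HasDerivAt.deriv (HasDerivAt.congr_deriv h ?_)
    norm_num
  rw [h1]
  have hV : HasDerivAt V₀ (deriv V₀ x) x := (hasDerivAt_V₀ x).differentiableAt.hasDerivAt
  have h2 := ((((hasDerivAt_pow 2 x).const_mul 3).div_const 6).mul (hasDerivAt_deriv_V₀ x)).add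
    (((hasDerivAt_pow 3 x).div_const 6).mul hV.exp.neg)
  have h3 := h2.deriv
  refine (congrArg (· + _) h3).trans ?_
  simp only [Pi.neg_apply]
  push_cast
  ring
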